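/- arXiv:1602.00382 — 3 statements merged into one kernel-verified Lean document; each statement's English description precedes it below -/
import Mathlib

section
/- Monotonicity of the per-eigenvalue covariance gap: For fixed reals a > 0 and N > 0, the function h(x) = (a·x − 1)² / (N·x·(2a·x − 1)) is non-increasing on the interval (1/(2a), 1/a). -/
/-- **Monotonicity of the per-eigenvalue covariance gap**: for fixed reals
`a > 0` and `N > 0`, the function `h(x) = (a·x − 1)² / (N·x·(2a·x − 1))` is
non-increasing on the interval `(1/(2a), 1/a)`. -/
theorem covariance_gap_antitoneOn (a N : ℝ) (ha : 0 < a) (hN : 0 < N) :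
    AntitoneOn (fun x : ℝ => (a * x - 1) ^ 2 / (N * x * (2 * a * x - 1)))
      (Set.Ioo (1 / (2 * a)) (1 / a)) := by
  rintro x ⟨hx, -⟩ y ⟨-, hy⟩ hxy
  have hx0 : 0 < x := lt_trans (by positivity) hx
  have hx1 : 0 < 2 * a * x - 1 := by
    rw [div_lt_iff₀ (by positivity)] at hx
    linarith
  have hy1 : a * y < 1 := by
    rw [lt_div_iff₀ ha] at hy
    linarith
  have hy0 : 0 < y := hx0.trans_le hxy
  have haxy : a * x ≤ a * y := by gcongr
  have hnum : (a * y - 1) ^ 2 ≤ (a * x - 1) ^ 2 := by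
    nlinarith
  have hden : N * x * (2 * a * x - 1) ≤ N * y * (2 * a * y - 1) := by gcongr
  exact div_le_div₀ (sq_nonneg _) hnum (by positivity) hden
end

section
/- Exact spectral norm of the covariance gap under an eigenvalue restriction: Let Γ ∈ ℝ^{M×M} be symmetric positive definite, N ≥ 1 an integer, and a > 0 such that every eigenvalue of Γ lies in the interval (1/(2a), 1/a]. Then the spectral norm of the difference between the distributed and centralized asymptotic covariances satisfies ‖ (a/(2N))·I + (1/(4N))·(Γ − I/(2a))^{−1} − (1/N)·Γ^{−1} ‖ = (a·λ_min − 1)² / (N·λ_min·(2a·λ_min − 1)), where λ_min is the minimum eigenvalue of Γ. -/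
open Matrix

noncomputable section

/-- The spectral (ℓ₂-operator) norm of a square real matrix. -/
noncomputable def specNorm {n : Type*} [Fintype n] [DecidableEq n]
    (A : Matrix n n ℝ) : ℝ :=
  ‖Matrix.toEuclideanCLM (𝕜 := ℝ) A‖

/-- The minimum eigenvalue of a square real matrix. -/
noncomputable def minEig {M : ℕ} (A : Matrix (Fin M) (Fin M) ℝ) : ℝ :=
  sInf {r : ℝ | Module.End.HasEigenvalue (Matrix.toLin' A) r}

open scoped Matrix.Norms.L2Operator in
lemma specNorm_conj_diagonal {n : Type*} [Fintype n] [DecidableEq n]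
    (U : unitary (Matrix n n ℝ)) (d : n → ℝ) :
    specNorm (Unitary.conjStarAlgAut ℝ _ U (diagonal d)) = ‖d‖ := by
  rw [specNorm, ← cstar_norm_def, Unitary.conjStarAlgAut_apply, ← Unitary.coe_star,
    CStarRing.norm_mul_coe_unitary, CStarRing.norm_coe_unitary_mul, l2_opNorm_diagonal]

lemma inv_conj_diagonal {n : Type*} [Fintype n] [DecidableEq n]
    (U : unitary (Matrix n n ℝ)) {d : n → ℝ} (hd : ∀ i, d i ≠ 0) :
    (Unitary.conjStarAlgAut ℝ _ U (diagonal d))⁻¹ =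
      Unitary.conjStarAlgAut ℝ _ U (diagonal fun i => (d i)⁻¹) := by
  refine inv_eq_right_inv ?_
  rw [← map_mul, diagonal_mul_diagonal]
  simp only [mul_inv_cancel₀ (hd _), diagonal_one, map_one]

lemma hasEigenvalue_toLin'_iff_mem_range {n : Type*} [Fintype n] [DecidableEq n]
    {A : Matrix n n ℝ} (hA : A.IsHermitian) (r : ℝ) :
    Module.End.HasEigenvalue (Matrix.toLin' A) r ↔ r ∈ Set.range hA.eigenvalues := by
  rw [Module.End.hasEigenvalue_iff_mem_spectrum, spectrum_toLin',
    hA.spectrum_real_eq_range_eigenvalues]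

lemma gap_eigenvalue_eq {a c l : ℝ} (ha : 0 < a) (hc : 0 < c) (hl : 1 / (2 * a) < l) :
    a / (2 * c) + 1 / (4 * c) * (l - (2 * a)⁻¹)⁻¹ - c⁻¹ * l⁻¹ =
      (a * l - 1) ^ 2 / (c * l * (2 * a * l - 1)) := by
  have hl0 : 0 < l := lt_trans (by positivity) hl
  have h1 : 0 < 2 * a * l - 1 := by
    rw [div_lt_iff₀ (by positivity)] at hl
    linarith
  have h2 : l - (2 * a)⁻¹ = (2 * a * l - 1) / (2 * a) := by field_simp
  have h3 := h1.ne'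
  rw [h2, inv_div]
  generalize hk : 2 * a * l - 1 = k at *
  field_simp
  subst hk
  ring

lemma gap_eigenvalue_nonneg {a c l : ℝ} (ha : 0 < a) (hc : 0 < c) (hl : 1 / (2 * a) < l) :
    0 ≤ (a * l - 1) ^ 2 / (c * l * (2 * a * l - 1)) := by
  have hl0 : 0 < l := lt_trans (by positivity) hl
  have h1 : 0 < 2 * a * l - 1 := by
    rw [div_lt_iff₀ (by positivity)] at hl
    linarith
  positivity

lemma gap_eigenvalue_antitoneOn {a c : ℝ} (ha : 0 < a) (hc : 0 < c) :
    AntitoneOn (fun l : ℝ => (a * l - 1) ^ 2 / (c * l * (2 * a * l - 1)))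
      (Set.Ioc (1 / (2 * a)) (1 / a)) := by
  rintro m ⟨hm, -⟩ l ⟨-, hl⟩ hml
  have hm0 : 0 < m := lt_trans (by positivity) hm
  have h1 : 0 < 2 * a * m - 1 := by
    rw [div_lt_iff₀ (by positivity)] at hm
    linarith
  have hl0 : 0 < l := hm0.trans_le hml
  have h2 : a * m ≤ a * l := by gcongr
  have h3 : a * l ≤ 1 := by
    rw [le_div_iff₀ ha] at hl
    linarith
  refine div_le_div₀ (sq_nonneg _) (by nlinarith) (by positivity) ?_
  gcongr

/-- **Exact spectral norm of the covariance gap under an eigenvalue restriction**: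
if `Γ` is symmetric positive definite with all eigenvalues in `(1/(2a), 1/a]`,
then `‖(a/(2N))·I + (1/(4N))·(Γ − I/(2a))⁻¹ − (1/N)·Γ⁻¹‖` equals
`(a·λ_min − 1)²/(N·λ_min·(2a·λ_min − 1))`, where `λ_min` is the minimum
eigenvalue of `Γ`. -/
theorem covariance_gap_specNorm {M : ℕ} (N : ℕ) (hN : 1 ≤ N)
    (Γ : Matrix (Fin M) (Fin M) ℝ) (hΓ : Γ.PosDef)
    (a : ℝ) (ha : 0 < a)
    (heig : ∀ r : ℝ, Module.End.HasEigenvalue (Matrix.toLin' Γ) r →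
      r ∈ Set.Ioc (1 / (2 * a)) (1 / a)) :
    specNorm
      ((a / (2 * (N : ℝ))) • (1 : Matrix (Fin M) (Fin M) ℝ)
        + (1 / (4 * (N : ℝ))) • (Γ - (2 * a)⁻¹ • 1)⁻¹
        - (N : ℝ)⁻¹ • Γ⁻¹) =
      (a * minEig Γ - 1) ^ 2 /
        ((N : ℝ) * minEig Γ * (2 * a * minEig Γ - 1)) := by
  have hc : (0 : ℝ) < N := by exact_mod_cast hN
  have hH := hΓ.isHermitian
  have hmem : ∀ i, hH.eigenvalues i ∈ Set.Ioc (1 / (2 * a)) (1 / a) := fun i =>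
    heig _ ((hasEigenvalue_toLin'_iff_mem_range hH _).2 ⟨i, rfl⟩)
  have hmin : minEig Γ = sInf (Set.range hH.eigenvalues) := by
    simp only [minEig, hasEigenvalue_toLin'_iff_mem_range hH, Set.ofPred_mem_eq]
  set d := hH.eigenvalues
  set φ := Unitary.conjStarAlgAut ℝ _ hH.eigenvectorUnitary
  have hΓd : Γ = φ (diagonal d) := hH.spectral_theorem
  have hshift : Γ - (2 * a)⁻¹ • 1 = φ (diagonal fun i => d i - (2 * a)⁻¹) := by
    rw [← diagonal_sub, map_sub, ← hΓd, ← smul_one_eq_diagonal, map_smul, map_one]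
  have hgap : (a / (2 * (N : ℝ))) • (1 : Matrix (Fin M) (Fin M) ℝ)
        + (1 / (4 * (N : ℝ))) • (Γ - (2 * a)⁻¹ • 1)⁻¹ - (N : ℝ)⁻¹ • Γ⁻¹ =
      φ (diagonal fun i => (a * d i - 1) ^ 2 / (N * d i * (2 * a * d i - 1))) := by
    have hinv : Γ⁻¹ = φ (diagonal fun i => (d i)⁻¹) := by
      rw [hΓd]
      exact inv_conj_diagonal _ fun i => (lt_trans (by positivity) (hmem i).1).ne'
    rw [hshift, inv_conj_diagonal _ fun i => sub_ne_zero.2 (by simpa using (hmem i).1.ne'), hinv,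
      ← map_one φ, ← map_smul, ← map_smul, ← map_smul, ← map_add, ← map_sub]
    congr 1
    simp only [← gap_eigenvalue_eq ha hc (hmem _).1, smul_one_eq_diagonal, ← diagonal_smul,
      diagonal_add, diagonal_sub, Pi.smul_def, smul_eq_mul]
  rw [hgap, specNorm_conj_diagonal]
  rcases isEmpty_or_nonempty (Fin M) with hM | hM
  · simp [hmin, Set.range_eq_empty, Pi.norm_def]
  obtain ⟨i₀, hi₀⟩ := (Set.range_nonempty d).csInf_mem (Set.finite_range d)
  have hle : ∀ i, d i₀ ≤ d i := fun i =>
    hi₀ ▸ csInf_le (Set.finite_range d).bddBelow ⟨i, rfl⟩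
  rw [hmin, ← hi₀]
  refine le_antisymm ((pi_norm_le_iff_of_nonneg (gap_eigenvalue_nonneg ha hc (hmem i₀).1)).2
    fun i => ?_) ?_
  · rw [Real.norm_of_nonneg (gap_eigenvalue_nonneg ha hc (hmem i).1)]
    exact gap_eigenvalue_antitoneOn ha hc (hmem i₀) (hmem i) (hle i)
  · refine le_trans (le_abs_self _) (norm_le_pi_norm
      (fun i => (a * d i - 1) ^ 2 / (N * d i * (2 * a * d i - 1))) i₀)
end
end

section
/- Lemma 7.3 (Fabian's deterministic recursion bound). Let {b_t}_{t∈ℕ} be a sequence of nonnegative real numbers satisfying b_{t+1} ≤ (1 − c/(t+1))·b_t + d_t·(t+1)^{−τ} for all t, where c > τ, τ > 0, and {d_t} is a summable sequence of nonnegative reals. Then limsup_{t→∞} (t+1)^τ · b_t < ∞. -/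
/-- The factor by which `(t + 1) ^ τ` grows is compensated by the contraction `1 - c x`. -/
theorem one_add_rpow_mul_one_sub_le_one {c τ x : ℝ} (hx : 0 ≤ x) (hτ : 0 ≤ τ) (hcτ : τ ≤ c) :
    (1 + x) ^ τ * (1 - c * x) ≤ 1 := by
  have hpow : (1 + x) ^ τ ≤ Real.exp (x * τ) := by
    rw [Real.exp_mul]
    exact Real.rpow_le_rpow (by linarith) (by linarith [Real.add_one_le_exp x]) hτ
  have hlin : 1 - c * x ≤ Real.exp (-(c * x)) := Real.one_sub_le_exp_neg _
  calc (1 + x) ^ τ * (1 - c * x)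
      ≤ (1 + x) ^ τ * Real.exp (-(c * x)) := by gcongr
    _ ≤ Real.exp (x * τ) * Real.exp (-(c * x)) := by gcongr
    _ = Real.exp (x * (τ - c)) := by rw [← Real.exp_add]; ring_nf
    _ ≤ 1 := Real.exp_le_one_iff.mpr (mul_nonpos_of_nonneg_of_nonpos hx (by linarith))

/-- One step of the recursion, rescaled by `s ^ τ`. -/
theorem add_one_rpow_mul_le {b b' d c τ s : ℝ} (hs : 1 ≤ s) (hb : 0 ≤ b) (hd : 0 ≤ d)
    (hτ : 0 ≤ τ) (hcτ : τ ≤ c) (hrec : b' ≤ (1 - c / s) * b + d * s ^ (-τ)) :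
    (s + 1) ^ τ * b' ≤ s ^ τ * b + 2 ^ τ * d := by
  have hs0 : 0 < s := by linarith
  have hsplit : (s + 1) ^ τ = s ^ τ * (1 + s⁻¹) ^ τ := by
    rw [← Real.mul_rpow hs0.le (by positivity)]
    congr 1
    field_simp
  have hcancel : s ^ τ * s ^ (-τ) = 1 := by
    rw [← Real.rpow_add hs0, add_neg_cancel, Real.rpow_zero]
  have hcontr := one_add_rpow_mul_one_sub_le_one (inv_nonneg.mpr hs0.le) hτ hcτ
  have htwo : (1 + s⁻¹) ^ τ ≤ 2 ^ τ :=
    Real.rpow_le_rpow (by positivity) (by linarith [inv_le_one_of_one_le₀ hs]) hτ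
  calc (s + 1) ^ τ * b'
      ≤ (s + 1) ^ τ * ((1 - c / s) * b + d * s ^ (-τ)) := by gcongr
    _ = ((1 + s⁻¹) ^ τ * (1 - c * s⁻¹)) * (s ^ τ * b)
          + (1 + s⁻¹) ^ τ * d * (s ^ τ * s ^ (-τ)) := by
        rw [hsplit, div_eq_mul_inv]; ring
    _ ≤ 1 * (s ^ τ * b) + 2 ^ τ * d * 1 := by rw [hcancel]; gcongr
    _ = s ^ τ * b + 2 ^ τ * d := by ring


/-- **Lemma 7.3** (Fabian's deterministic recursion bound). If a nonnegative
sequence `{b_t}` satisfies `b_{t+1} ≤ (1 − c/(t+1))·b_t + d_t·(t+1)^{−τ}` for all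
`t`, where `c > τ > 0` and `{d_t}` is a summable nonnegative sequence, then
`limsup_{t→∞} (t+1)^τ·b_t < ∞`. -/
theorem fabian_recursion_bound (b d : ℕ → ℝ) (c τ : ℝ)
    (hb : ∀ t, 0 ≤ b t) (hd : ∀ t, 0 ≤ d t)
    (hτ : 0 < τ) (hcτ : τ < c) (hsum : Summable d)
    (hrec : ∀ t : ℕ,
      b (t + 1) ≤ (1 - c / ((t : ℝ) + 1)) * b t + d t * ((t : ℝ) + 1) ^ (-τ)) :
    Filter.IsBoundedUnder (· ≤ ·) Filter.atTop
      (fun t : ℕ => ((t : ℝ) + 1) ^ τ * b t) := by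
  have hstep (t : ℕ) := add_one_rpow_mul_le (s := (t : ℝ) + 1) (by simp) (hb t) (hd t)
    hτ.le hcτ.le (hrec t)
  have hbound (t : ℕ) :
      ((t : ℝ) + 1) ^ τ * b t ≤ b 0 + 2 ^ τ * ∑ i ∈ Finset.range t, d i := by
    induction t with
    | zero => simp
    | succ t ih =>
      rw [Finset.sum_range_succ, mul_add, Nat.cast_succ]
      linarith [hstep t]
  refine Filter.isBoundedUnder_of ⟨b 0 + 2 ^ τ * ∑' i, d i, fun t => (hbound t).trans ?_⟩
  gcongr
  exact hsum.sum_le_tsum _ fun i _ => hd i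
end
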